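/- arXiv:1907.11614 — 7 statements merged into one kernel-verified Lean document; each statement's English description precedes it below -/
import Mathlib

section
/- Let s ≥ 1 and let p_i, q_i (1 ≤ i ≤ s) be integers with gcd(p_i,q_i) = 1 and 1 < p_i < q_i for every i, and p_i·p_{i+1}·q_i < q_{i+1} for every 1 ≤ i ≤ s−1. Define integers l_i by l_1 = −2(q_1−1)(p_1−1)+2 and l_i = −2q_i p_i + 2q_i + p_i·l_{i−1} for 2 ≤ i ≤ s. Then for every i with 1 ≤ i ≤ s one has −2 q_i p_i < l_i < 0. -/
/-- bounds on the recursively defined integers `l i` attached to the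
type `{(p_1,q_1),…,(p_s,q_s)}` of an algebraic iterated torus knot. -/
theorem stmt_0 (s : ℕ) (hs : 1 ≤ s) (p q l : ℕ → ℤ)
    (hcop : ∀ i, 1 ≤ i → i ≤ s → Int.gcd (p i) (q i) = 1)
    (hp : ∀ i, 1 ≤ i → i ≤ s → 1 < p i)
    (hpq : ∀ i, 1 ≤ i → i ≤ s → p i < q i)
    (hchain : ∀ i, 1 ≤ i → i < s → p i * p (i + 1) * q i < q (i + 1))
    (hl1 : l 1 = -2 * (q 1 - 1) * (p 1 - 1) + 2)
    (hlrec : ∀ i, 2 ≤ i → i ≤ s → l i = -2 * q i * p i + 2 * q i + p i * l (i - 1)) :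
    ∀ i, 1 ≤ i → i ≤ s → -2 * q i * p i < l i ∧ l i < 0 := by
  intro i hi
  induction i, hi using Nat.le_induction with
  | base =>
    intro h
    have hp1 := hp 1 le_rfl h
    have hq1 := hpq 1 le_rfl h
    rw [hl1]
    constructor <;> nlinarith
  | succ n hn ih =>
    intro h
    obtain ⟨hlow, hneg⟩ := ih (by omega)
    have hP := hp (n + 1) (by omega) h
    have hQ := hpq (n + 1) (by omega) h
    have hc := hchain n hn (by omega)
    have hl := hlrec (n + 1) (by omega) h
    rw [Nat.add_sub_cancel] at hl
    have hlow' := mul_lt_mul_of_pos_left hlow (by linarith : 0 < p (n + 1))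
    rw [hl]
    constructor <;> nlinarith
end

section
/- Let a ≥ b ≥ 1 and a' ≥ b' ≥ 1 be integers. If J_{a,b} = J_{a',b'} in ℤ[t], then either (a,b) = (a',b') or {(a,b),(a',b')} = {(2,1),(3,1)}. (In particular J_{2,1} = J_{3,1}, and apart from this coincidence the polynomials J_{a,b} are pairwise distinct.) -/
open Polynomial

/-- Normalized Jones polynomial of the knot `K_{a,b}` (for `a ≥ b ≥ 1`). -/
noncomputable def J (a b : ℕ) : Polynomial ℤ :=
  1 - X - X ^ (a + b + 2) + X ^ (a + b + 3) + X ^ (a * b + 2 * b + 1)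
    - X ^ (a * b + a + b + 1) - X ^ (a * b + a + b + 3) + X ^ (a * b + 2 * a + 1)

/-- Normalized Jones polynomial of the knot `K'_{a,b}` (for `a ≥ b ≥ 1`). -/
noncomputable def J' (a b : ℕ) : Polynomial ℤ :=
  -1 + X + X ^ (a + b) - X ^ (a + b + 1) + X ^ (a * b + 2 * b)
    - X ^ (a * b + a + b) - X ^ (a * b + a + b + 2) + X ^ (a * b + 2 * a)

/-- Normalized Jones polynomial of the knot `K''_{a,b}` (for `a > 1`, `b ≥ 1`). -/
noncomputable def J'' (a b : ℕ) : Polynomial ℤ :=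
  1 - X ^ (a + b) - X ^ (a + b + 2) + X ^ (2 * a + 2 * b)
    - X ^ (a * b + a + b + 1) + X ^ (a * b + a + b + 2)
    + X ^ (a * b + 2 * a - 1) - X ^ (a * b + 2 * a)

/-- Normalized Jones polynomial of the torus knot `T(n,n+1)` (for `n ≥ 2`). -/
noncomputable def Θ (n : ℕ) : Polynomial ℤ :=
  1 - X ^ (n + 1) - X ^ (n + 2) + X ^ (2 * n + 1)

theorem coeff_J (a b n : ℕ) : (J a b).coeff n =
    (if n = 0 then 1 else 0) - (if n = 1 then 1 else 0) - (if n = a + b + 2 then 1 else 0)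
      + (if n = a + b + 3 then 1 else 0) + (if n = a * b + 2 * b + 1 then 1 else 0)
      - (if n = a * b + a + b + 1 then 1 else 0) - (if n = a * b + a + b + 3 then 1 else 0)
      + (if n = a * b + 2 * a + 1 then 1 else 0) := by
  simp only [J, coeff_add, coeff_sub, coeff_X_pow, coeff_one, coeff_X, eq_comm (a := 1) (b := n)]

/-- For `b ≥ 2` the first term of `J a b` after `1 - X` is `-X ^ (a + b + 2)`. -/
theorem J_coeff_of_two_le {a b : ℕ} (hb : 2 ≤ b) (hab : b ≤ a) :
    (J a b).coeff (a + b + 2) = -1 ∧ ∀ k, 2 ≤ k → k < a + b + 2 → (J a b).coeff k = 0 := by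
  have hp : a * 2 ≤ a * b := Nat.mul_le_mul_left a hb
  simp only [coeff_J]
  generalize a * b = p at hp
  refine ⟨?_, fun k hk hk' => ?_⟩ <;> split_ifs <;> first | contradiction | omega

/-- For `b = 1` the first term of `J a b` after `1 - X` has coefficient `1`. -/
theorem exists_J_one_coeff {a : ℕ} (ha : 1 ≤ a) :
    ∃ m, 2 ≤ m ∧ (J a 1).coeff m = 1 ∧ ∀ k, 2 ≤ k → k < m → (J a 1).coeff k = 0 := by
  simp only [coeff_J, mul_one]
  obtain rfl | rfl | ha : a = 1 ∨ a = 2 ∨ 3 ≤ a := by omega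
  · exact ⟨5, by norm_num, by norm_num, fun k _ _ => by interval_cases k <;> norm_num⟩
  · exact ⟨7, by norm_num, by norm_num, fun k _ _ => by interval_cases k <;> norm_num⟩
  · refine ⟨a + 4, by omega, ?_, fun k _ _ => ?_⟩ <;> split_ifs <;> first | contradiction | omega

theorem eval_one_derivative_derivative_X_pow (n : ℕ) :
    (derivative (derivative (X ^ n : ℤ[X]))).eval 1 = (n : ℤ) ^ 2 - n := by
  cases n <;> simp [derivative_X_pow] ; ring

/-- The second derivative of `J a b` at `1`. -/
theorem eval_one_derivative_derivative_J (a b : ℕ) :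
    (derivative (derivative (J a b))).eval 1 =
      2 * ((a : ℤ) + b) ^ 2 - 12 * (a * b) - 2 * (a + b) - 2 := by
  simp only [J, derivative_add, derivative_sub, eval_add, eval_sub,
    eval_one_derivative_derivative_X_pow, derivative_one, derivative_X, derivative_zero, eval_zero]
  push_cast
  ring

theorem J_ne_J_one {a b a' : ℕ} (hb : 2 ≤ b) (hab : b ≤ a) (ha' : 1 ≤ a') :
    J a b ≠ J a' 1 := by
  intro h
  obtain ⟨h₁, h₂⟩ := J_coeff_of_two_le hb hab
  obtain ⟨m, hm, h₃, h₄⟩ := exists_J_one_coeff ha'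
  rw [h] at h₁ h₂
  rcases lt_trichotomy m (a + b + 2) with hlt | rfl | hlt
  · simp [h₂ m hm hlt] at h₃
  · simp [h₁] at h₃
  · simp [h₄ _ (by omega) hlt] at h₁

theorem add_le_add_of_J_eq {a b a' b' : ℕ} (hb : 2 ≤ b) (hab : b ≤ a) (hb' : 2 ≤ b')
    (hab' : b' ≤ a') (h : J a b = J a' b') : a' + b' ≤ a + b := by
  by_contra! hlt
  have h₁ := (J_coeff_of_two_le hb hab).1
  rw [h, (J_coeff_of_two_le hb' hab').2 _ (by omega) (by omega)] at h₁
  norm_num at h₁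

/-- the polynomials `J_{a,b}`, `a ≥ b ≥ 1`, are pairwise distinct,
except for the single coincidence `J_{2,1} = J_{3,1}`. -/
theorem stmt_8 (a b a' b' : ℕ) (hb : 1 ≤ b) (hab : b ≤ a) (hb' : 1 ≤ b') (hab' : b' ≤ a')
    (h : J a b = J a' b') :
    (a = a' ∧ b = b') ∨
      ((a, b) = (2, 1) ∧ (a', b') = (3, 1)) ∨ ((a, b) = (3, 1) ∧ (a', b') = (2, 1)) := by
  have hd := congrArg (fun P : ℤ[X] => (derivative (derivative P)).eval 1) h
  simp only [eval_one_derivative_derivative_J] at hd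
  obtain rfl | hb₂ : b = 1 ∨ 2 ≤ b := by omega
  · obtain rfl | hb₂' : b' = 1 ∨ 2 ≤ b' := by omega
    · have hz : ((a : ℤ) - a') * (a + a' - 5) = 0 := by push_cast at hd; linarith
      rcases mul_eq_zero.mp hz with hz | hz
      · left; omega
      have hc := congrArg (fun P : ℤ[X] => P.coeff 5) h
      obtain ⟨rfl, rfl⟩ | ⟨rfl, rfl⟩ | ⟨rfl, rfl⟩ | ⟨rfl, rfl⟩ :
          (a = 1 ∧ a' = 4) ∨ (a = 2 ∧ a' = 3) ∨ (a = 3 ∧ a' = 2) ∨ (a = 4 ∧ a' = 1) := by omega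
      · simp [coeff_J] at hc
      · simp
      · simp
      · simp [coeff_J] at hc
    · exact (J_ne_J_one hb₂' hab' hab h.symm).elim
  · obtain rfl | hb₂' : b' = 1 ∨ 2 ≤ b' := by omega
    · exact (J_ne_J_one hb₂ hab hab' h).elim
    · have hs : a + b = a' + b' :=
        (add_le_add_of_J_eq hb₂' hab' hb₂ hab h.symm).antisymm
          (add_le_add_of_J_eq hb₂ hab hb₂' hab' h)
      have hs' : (a : ℤ) + b = a' + b' := mod_cast hs
      rw [hs'] at hd
      have hp : (a : ℤ) * b = a' * b' := by linarith
      have hz : ((a : ℤ) - a') * (a - b') = 0 := by linear_combination a * hs' - hp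
      left
      rcases mul_eq_zero.mp hz with hz | hz <;> omega
end

section
/- Let a ≥ b ≥ 1 and a' ≥ b' ≥ 1 be integers. If J'_{a,b} = J'_{a',b'} in ℤ[t], then (a,b) = (a',b'). That is, the polynomials J'_{a,b} for a ≥ b ≥ 1 are pairwise distinct. -/
open Polynomial

/-- The value at `1` of `t d/dt (t d/dt p)`: the sum of the squared exponents of `p`, weighted by
the coefficients. -/
noncomputable def secondMoment : Polynomial ℤ →+ ℤ where
  toFun p := eval 1 (derivative (X * derivative p))
  map_zero' := by simp
  map_add' p q := by simp [mul_add]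

theorem secondMoment_X_pow (n : ℕ) : secondMoment (X ^ n) = (n : ℤ) ^ 2 := by
  change eval 1 (derivative (X * derivative (X ^ n : Polynomial ℤ))) = _
  rcases n with _ | n
  · simp
  · simp [derivative_X_pow]
    ring

theorem secondMoment_J' (a b : ℕ) :
    secondMoment (J' a b) = 2 * ((a + b : ℕ) : ℤ) ^ 2 - 6 * (a + b : ℕ) - 12 * (a * b : ℕ) - 4 := by
  have h0 := secondMoment_X_pow 0
  have h1 := secondMoment_X_pow 1
  rw [pow_zero] at h0
  rw [pow_one] at h1
  simp only [J', map_add, map_sub, map_neg, secondMoment_X_pow, h0, h1]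
  push_cast
  ring

theorem coeff_J'_add {a b : ℕ} (hb : 1 ≤ b) (hab : b ≤ a) : (J' a b).coeff (a + b) = 1 := by
  have h1 : a ≤ a * b := Nat.le_mul_of_pos_right a hb
  simp only [J', coeff_add, coeff_sub, coeff_neg, coeff_X_pow, coeff_one, coeff_X]
  repeat rw [if_neg (by omega)]
  simp
  grind

theorem coeff_J'_eq_zero {a b k : ℕ} (hb : 1 ≤ b) (hab : b ≤ a) (hk : 2 ≤ k) (hkab : k < a + b) :
    (J' a b).coeff k = 0 := by
  have h1 : a ≤ a * b := Nat.le_mul_of_pos_right a hb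
  simp only [J', coeff_add, coeff_sub, coeff_neg, coeff_X_pow, coeff_one, coeff_X]
  repeat rw [if_neg (by omega)]
  simp

theorem add_le_add_of_J'_eq {a b a' b' : ℕ} (hb : 1 ≤ b) (hab : b ≤ a) (hb' : 1 ≤ b')
    (hab' : b' ≤ a') (h : J' a b = J' a' b') : a' + b' ≤ a + b := by
  by_contra! hlt
  have h1 := coeff_J'_add hb hab
  rw [h, coeff_J'_eq_zero hb' hab' (by omega) hlt] at h1
  exact zero_ne_one h1

/-- the polynomials `J'_{a,b}`, `a ≥ b ≥ 1`, are pairwise distinct. -/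
theorem stmt_9 (a b a' b' : ℕ) (hb : 1 ≤ b) (hab : b ≤ a) (hb' : 1 ≤ b') (hab' : b' ≤ a')
    (h : J' a b = J' a' b') : a = a' ∧ b = b' := by
  have hs : a + b = a' + b' :=
    le_antisymm (add_le_add_of_J'_eq hb' hab' hb hab h.symm) (add_le_add_of_J'_eq hb hab hb' hab' h)
  have hm := congrArg secondMoment h
  rw [secondMoment_J', secondMoment_J', hs] at hm
  have hp : a * b = a' * b' := by omega
  zify at *
  have hd : (a - b : ℤ) = a' - b' := by
    rw [← sq_eq_sq₀ (by linarith) (by linarith)]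
    linear_combination (a + b + a' + b' : ℤ) * hs - 4 * hp
  constructor <;> linarith
end

section
/- The three families of polynomials are pairwise disjoint: for all integers a ≥ b ≥ 1, a' ≥ b' ≥ 1, a'' > 1, b'' ≥ 1 one has J_{a,b} ≠ J'_{a',b'}, J_{a,b} ≠ J''_{a'',b''}, and J'_{a',b'} ≠ J''_{a'',b''} in ℤ[t]. -/
open Polynomial

theorem coeff_X_pow_eq_zero_of_lt {k n : ℕ} (h : k < n) : (X ^ n : ℤ[X]).coeff k = 0 := by
  rw [coeff_X_pow, if_neg h.ne]

theorem J_coeff_zero (a b : ℕ) : (J a b).coeff 0 = 1 := by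
  simp only [J, coeff_sub, coeff_add, coeff_one_zero, coeff_X_zero]
  iterate 6 rw [coeff_X_pow_eq_zero_of_lt (by omega)]
  norm_num

theorem J_coeff_one {a b : ℕ} (ha : 1 ≤ a) (hb : 1 ≤ b) : (J a b).coeff 1 = -1 := by
  simp only [J, coeff_sub, coeff_add, coeff_one, coeff_X_one]
  iterate 6 rw [coeff_X_pow_eq_zero_of_lt (by omega)]
  norm_num

theorem J'_coeff_zero {a b : ℕ} (ha : 1 ≤ a) (hb : 1 ≤ b) : (J' a b).coeff 0 = -1 := by
  simp only [J', coeff_sub, coeff_add, coeff_neg, coeff_one_zero, coeff_X_zero]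
  iterate 6 rw [coeff_X_pow_eq_zero_of_lt (by omega)]
  norm_num

theorem J''_coeff {a b k : ℕ} (ha : 1 < a) (hb : 1 ≤ b) (hk : k ≤ 1) :
    (J'' a b).coeff k = (1 : ℤ[X]).coeff k := by
  simp only [J'', coeff_sub, coeff_add]
  iterate 7 rw [coeff_X_pow_eq_zero_of_lt (by omega)]
  norm_num

/-- the three families `J`, `J'`, `J''` are pairwise disjoint. -/
theorem stmt_11 (a b a' b' a'' b'' : ℕ) (hb : 1 ≤ b) (hab : b ≤ a)
    (hb' : 1 ≤ b') (hab' : b' ≤ a') (ha'' : 1 < a'') (hb'' : 1 ≤ b'') :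
    J a b ≠ J' a' b' ∧ J a b ≠ J'' a'' b'' ∧ J' a' b' ≠ J'' a'' b'' := by
  have hJ' := J'_coeff_zero (hb'.trans hab') hb'
  refine ⟨fun h => ?_, fun h => ?_, fun h => ?_⟩
  · rw [← h, J_coeff_zero] at hJ'
    norm_num at hJ'
  · have hJ := J_coeff_one (hb.trans hab) hb
    rw [h, J''_coeff ha'' hb'' le_rfl, coeff_one] at hJ
    norm_num at hJ
  · rw [h, J''_coeff ha'' hb'' zero_le_one, coeff_one_zero] at hJ'
    norm_num at hJ'
end

section
/- For all integers n ≥ 2, a ≥ b ≥ 1, a' ≥ b' ≥ 1, a'' > 1, b'' ≥ 1 one has J_{a,b} ≠ Θ_n, J'_{a',b'} ≠ Θ_n, and J''_{a'',b''} ≠ Θ_n in ℤ[t]. (Hence none of the one-crossing knots has the normalized Jones polynomial of a torus knot T(n,n+1), so the three families have Hopf crossing number exactly one.) -/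
open Polynomial

theorem J_ne_Θ {n a b : ℕ} (hn : 2 ≤ n) (hb : 1 ≤ b) (hab : b ≤ a) : J a b ≠ Θ n := by
  intro h
  have hm : 1 ≤ a * b := Nat.mul_pos (by omega) hb
  have h1 := congrArg (fun p => p.coeff 1) h
  simp only [J, Θ, coeff_add, coeff_sub, coeff_one, coeff_X_one, coeff_X_pow, one_ne_zero, if_false] at h1
  generalize a * b = m at hm h1
  omega

theorem J'_ne_Θ {n a b : ℕ} (hb : 1 ≤ b) (hab : b ≤ a) : J' a b ≠ Θ n := by
  intro h
  have h0 := congrArg (fun p => p.coeff 0) h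
  simp only [J', Θ, coeff_add, coeff_sub, coeff_neg, coeff_one_zero, coeff_X_zero, coeff_X_pow]
    at h0
  generalize a * b = m at h0
  omega

/-- The lowest positive exponents of `J''` and `Θ` force `a + b = n + 1`; then the coefficients
of `X ^ (n + 2)` disagree. -/
theorem J''_ne_Θ {n a b : ℕ} (hn : 2 ≤ n) (ha : 1 < a) (hb : 1 ≤ b) : J'' a b ≠ Θ n := by
  intro h
  have hm : b + 3 ≤ a * b + a := by nlinarith
  have hma : a ≤ a * b := Nat.le_mul_of_pos_right a hb
  have hcoeff (k : ℕ) := congrArg (fun p => p.coeff k) h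
  simp only [J'', Θ, coeff_add, coeff_sub, coeff_one, coeff_X_pow] at hcoeff
  generalize a * b = m at hm hma hcoeff
  have hab : a + b = n + 1 := by
    rcases lt_trichotomy (a + b) (n + 1) with hlt | heq | hgt
    · have := hcoeff (a + b)
      omega
    · exact heq
    · have := hcoeff (n + 1)
      omega
  have := hcoeff (n + 2)
  omega

/-- none of the polynomials `J_{a,b}`, `J'_{a,b}`, `J''_{a,b}` equals a
polynomial `Θ_n` of a torus knot `T(n,n+1)`. -/
theorem stmt_12 (n a b a' b' a'' b'' : ℕ) (hn : 2 ≤ n) (hb : 1 ≤ b) (hab : b ≤ a)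
    (hb' : 1 ≤ b') (hab' : b' ≤ a') (ha'' : 1 < a'') (hb'' : 1 ≤ b'') :
    J a b ≠ Θ n ∧ J' a' b' ≠ Θ n ∧ J'' a'' b'' ≠ Θ n := by
  exact ⟨J_ne_Θ hn hb hab, J'_ne_Θ hb' hab', J''_ne_Θ hn ha'' hb''⟩
end

section
/- For all admissible parameters, the polynomial 1 − t² divides each of J_{a,b} (a ≥ b ≥ 1), J'_{a,b} (a ≥ b ≥ 1) and J''_{a,b} (a > 1, b ≥ 1) in ℤ[t], and every coefficient of the corresponding quotient polynomial lies in {−2, −1, 0, 1, 2}. (Hence the Jones polynomial of every knot with Hopf crossing number one has all coefficients of absolute value at most 2.) -/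
open Polynomial

/-- The quotient of `X ^ (n % 2) - X ^ n` by `1 - X ^ 2`. -/
noncomputable def parityQuotient : ℕ → Polynomial ℤ
  | 0 => 0
  | 1 => 0
  | n + 2 => parityQuotient n + X ^ n

theorem X_pow_eq_sub_parityQuotient (n : ℕ) :
    (X : Polynomial ℤ) ^ n = X ^ (n % 2) - (1 - X ^ 2) * parityQuotient n := by
  induction n using Nat.twoStepInduction with
  | zero => simp [parityQuotient]
  | one => simp [parityQuotient]
  | more n ih _ =>
    rw [parityQuotient, Nat.add_mod_right]
    linear_combination ih

theorem coeff_parityQuotient (n k : ℕ) :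
    (parityQuotient n).coeff k = if k < n ∧ k % 2 = n % 2 then 1 else 0 := by
  induction n using Nat.twoStepInduction with
  | zero => simp [parityQuotient]
  | one => simp [parityQuotient]; omega
  | more n ih _ =>
    rw [parityQuotient, coeff_add, ih, coeff_X_pow]
    split_ifs <;> omega

/-- Divisibility by `1 - X ^ 2` and bounded quotient coefficients for a sum of four monomials minus
a sum of four monomials, in terms of the exponents. -/
theorem exists_quotient_coeff_mem {P : Polynomial ℤ} (e₁ e₂ e₃ e₄ f₁ f₂ f₃ f₄ : ℕ)
    (hP : P = X ^ e₁ + X ^ e₂ + X ^ e₃ + X ^ e₄ - (X ^ f₁ + X ^ f₂ + X ^ f₃ + X ^ f₄))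
    (hparity : e₁ % 2 + e₂ % 2 + e₃ % 2 + e₄ % 2 = f₁ % 2 + f₂ % 2 + f₃ % 2 + f₄ % 2)
    (hbound : ∀ k : ℕ, ∀ u : ℕ → ℤ,
      (∀ n, (k + n) % 2 = 1 → u n = 0) →
      (∀ n, (k + n) % 2 = 0 → u n = if k < n then 1 else 0) →
      |u f₁ + u f₂ + u f₃ + u f₄ - (u e₁ + u e₂ + u e₃ + u e₄)| ≤ 2) :
    ∃ Q : Polynomial ℤ, P = (1 - X ^ 2) * Q ∧
      ∀ k : ℕ, Q.coeff k ∈ ({-2, -1, 0, 1, 2} : Set ℤ) := by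
  have X_pow_mod (n : ℕ) :
      (X : Polynomial ℤ) ^ (n % 2) = 1 + ((n % 2 : ℕ) : Polynomial ℤ) * (X - 1) := by
    rcases Nat.mod_two_eq_zero_or_one n with h | h <;> simp [h]
  refine ⟨parityQuotient f₁ + parityQuotient f₂ + parityQuotient f₃ + parityQuotient f₄ -
    (parityQuotient e₁ + parityQuotient e₂ + parityQuotient e₃ + parityQuotient e₄), ?_, ?_⟩
  · have h := congrArg (Nat.cast : ℕ → Polynomial ℤ) hparity
    simp only [Nat.cast_add] at h
    rw [hP, X_pow_eq_sub_parityQuotient e₁, X_pow_eq_sub_parityQuotient e₂,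
      X_pow_eq_sub_parityQuotient e₃, X_pow_eq_sub_parityQuotient e₄,
      X_pow_eq_sub_parityQuotient f₁, X_pow_eq_sub_parityQuotient f₂,
      X_pow_eq_sub_parityQuotient f₃, X_pow_eq_sub_parityQuotient f₄]
    simp only [X_pow_mod]
    linear_combination (X - 1) * h
  · intro k
    have h := abs_le.mp (hbound k (fun n => (parityQuotient n).coeff k)
      (fun n hn => by rw [coeff_parityQuotient, if_neg (by omega)])
      (fun n hn => by
        rw [coeff_parityQuotient]
        exact if_congr (and_iff_left (by omega)) rfl rfl))
    simp only [coeff_sub, coeff_add, Set.mem_insert_iff, Set.mem_singleton_iff]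
    omega

theorem mul_mod_two_cases (a b : ℕ) :
    a % 2 = 0 ∧ a * b % 2 = 0 ∨ b % 2 = 0 ∧ a * b % 2 = 0 ∨
      a % 2 = 1 ∧ b % 2 = 1 ∧ a * b % 2 = 1 := by
  rcases Nat.mod_two_eq_zero_or_one a with ha | ha <;>
    rcases Nat.mod_two_eq_zero_or_one b with hb | hb <;> simp [Nat.mul_mod, ha, hb]

theorem J_exists_quotient {a b : ℕ} (hb : 1 ≤ b) (hba : b ≤ a) :
    ∃ Q : Polynomial ℤ, J a b = (1 - X ^ 2) * Q ∧
      ∀ k : ℕ, Q.coeff k ∈ ({-2, -1, 0, 1, 2} : Set ℤ) := by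
  have hm := mul_mod_two_cases a b
  have ham : a ≤ a * b := Nat.le_mul_of_pos_right a (by omega)
  have hbm : b ≤ a * b := Nat.le_mul_of_pos_left b (by omega)
  refine exists_quotient_coeff_mem 0 (a + b + 3) (a * b + 2 * b + 1) (a * b + 2 * a + 1)
    1 (a + b + 2) (a * b + a + b + 1) (a * b + a + b + 3) (by rw [J]; ring) ?_ ?_
  · generalize a * b = m at *
    omega
  · intro k u hu_odd hu_even
    generalize a * b = m at *
    rw [abs_le]
    rcases Nat.mod_two_eq_zero_or_one k with hk | hk <;>
      rcases Nat.mod_two_eq_zero_or_one a with ha2 | ha2 <;>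
      rcases Nat.mod_two_eq_zero_or_one b with hb2 | hb2 <;>
      simp (disch := omega) only [hu_odd, hu_even] <;>
      clear hu_odd hu_even <;>
      split_ifs <;>
      omega

theorem J'_exists_quotient {a b : ℕ} (hb : 1 ≤ b) (hba : b ≤ a) :
    ∃ Q : Polynomial ℤ, J' a b = (1 - X ^ 2) * Q ∧
      ∀ k : ℕ, Q.coeff k ∈ ({-2, -1, 0, 1, 2} : Set ℤ) := by
  have hm := mul_mod_two_cases a b
  have ham : a ≤ a * b := Nat.le_mul_of_pos_right a (by omega)
  have hbm : b ≤ a * b := Nat.le_mul_of_pos_left b (by omega)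
  refine exists_quotient_coeff_mem 1 (a + b) (a * b + 2 * b) (a * b + 2 * a)
    0 (a + b + 1) (a * b + a + b) (a * b + a + b + 2) (by rw [J']; ring) ?_ ?_
  · generalize a * b = m at *
    omega
  · intro k u hu_odd hu_even
    generalize a * b = m at *
    rw [abs_le]
    rcases Nat.mod_two_eq_zero_or_one k with hk | hk <;>
      rcases Nat.mod_two_eq_zero_or_one a with ha2 | ha2 <;>
      rcases Nat.mod_two_eq_zero_or_one b with hb2 | hb2 <;>
      simp (disch := omega) only [hu_odd, hu_even] <;>
      clear hu_odd hu_even <;>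
      split_ifs <;>
      omega

theorem J''_exists_quotient {a b : ℕ} (ha : 1 < a) (hb : 1 ≤ b) :
    ∃ Q : Polynomial ℤ, J'' a b = (1 - X ^ 2) * Q ∧
      ∀ k : ℕ, Q.coeff k ∈ ({-2, -1, 0, 1, 2} : Set ℤ) := by
  have hm := mul_mod_two_cases a b
  have ham : a ≤ a * b := Nat.le_mul_of_pos_right a (by omega)
  have hbm : b ≤ a * b := Nat.le_mul_of_pos_left b (by omega)
  refine exists_quotient_coeff_mem 0 (2 * a + 2 * b) (a * b + a + b + 2) (a * b + 2 * a - 1)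
    (a + b) (a + b + 2) (a * b + a + b + 1) (a * b + 2 * a) (by rw [J'']; ring) ?_ ?_
  · generalize a * b = m at *
    omega
  · intro k u hu_odd hu_even
    generalize a * b = m at *
    rw [abs_le]
    rcases Nat.mod_two_eq_zero_or_one k with hk | hk <;>
      rcases Nat.mod_two_eq_zero_or_one a with ha2 | ha2 <;>
      rcases Nat.mod_two_eq_zero_or_one b with hb2 | hb2 <;>
      simp (disch := omega) only [hu_odd, hu_even] <;>
      clear hu_odd hu_even <;>
      split_ifs <;>
      omega

/-- `1 − t²` divides each of `J_{a,b}`, `J'_{a,b}`, `J''_{a,b}` and all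
coefficients of the quotient (the Jones polynomial of the corresponding knot, up to a
power of `t`) lie in `{−2,−1,0,1,2}`. -/
theorem stmt_14 (a b : ℕ) :
    (1 ≤ b → b ≤ a → ∃ Q : Polynomial ℤ, J a b = (1 - X ^ 2) * Q ∧
      ∀ k : ℕ, Q.coeff k ∈ ({-2, -1, 0, 1, 2} : Set ℤ)) ∧
    (1 ≤ b → b ≤ a → ∃ Q : Polynomial ℤ, J' a b = (1 - X ^ 2) * Q ∧
      ∀ k : ℕ, Q.coeff k ∈ ({-2, -1, 0, 1, 2} : Set ℤ)) ∧
    (1 < a → 1 ≤ b → ∃ Q : Polynomial ℤ, J'' a b = (1 - X ^ 2) * Q ∧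
      ∀ k : ℕ, Q.coeff k ∈ ({-2, -1, 0, 1, 2} : Set ℤ)) :=
  ⟨J_exists_quotient, J'_exists_quotient, J''_exists_quotient⟩
end

section
/- Let p ≥ 1 be an integer and let q be an odd integer with q > 2p(p+1). Define P_{p,q} := 1 − t^{2p+1} − t^{2p+3} + t^{4p+2} + t^{p²+3p+1} − t^{p²+3p+2} − t^{q−p²+p+1} + t^{q−p²+p+2} ∈ ℤ[t] (this is the normalized Jones polynomial of the algebraic doubly iterated torus knot of type {(p,p+1),(2,q)}). Then there exist integers a > 1, b ≥ 1 with P_{p,q} = J''_{a,b} if and only if q = 2p(p+1)+1; moreover in that case necessarily a = p+1 and b = p, i.e. P_{p,2p(p+1)+1} = J''_{p+1,p}. (Hence an algebraic knot of type {(p,p+1),(2,q)} has Hopf crossing number at most one only if q = 2p(p+1)+1, and then it is the knot K''_{p+1,p}.) -/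
open Polynomial

/-- Normalized Jones polynomial of the algebraic doubly iterated torus knot of type
`{(p,p+1),(2,q)}` (for `p ≥ 1` and `q` odd with `q > 2p(p+1)`). -/
noncomputable def P (p q : ℕ) : Polynomial ℤ :=
  1 - X ^ (2 * p + 1) - X ^ (2 * p + 3) + X ^ (4 * p + 2)
    + X ^ (p ^ 2 + 3 * p + 1) - X ^ (p ^ 2 + 3 * p + 2)
    - X ^ (q - p ^ 2 + p + 1) + X ^ (q - p ^ 2 + p + 2)

theorem exponents_eq_of_mul_one_sub_X_eq {A B C D : ℕ} (hAB : A ≠ B)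
    (h : (X ^ A - X ^ (A + 1) - X ^ B + X ^ (B + 1) : ℤ[X]) =
      X ^ D - X ^ (D + 1) - X ^ C + X ^ (C + 1)) : D = A ∧ C = B := by
  have hX : (1 - X : ℤ[X]) ≠ 0 := fun h0 => by
    simpa [coeff_one, coeff_X] using congrArg (coeff · 1) h0
  have hdiff : (X ^ A - X ^ B : ℤ[X]) = X ^ D - X ^ C := by
    apply mul_left_cancel₀ hX
    linear_combination h
  have hA := congrArg (coeff · A) hdiff
  have hB := congrArg (coeff · B) hdiff
  simp only [coeff_sub, coeff_X_pow] at hA hB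
  constructor <;> split_ifs at hA hB <;> omega

theorem add_eq_of_P_eq_J'' {p q a b : ℕ} (hp : 1 ≤ p) (hq : 2 * p * (p + 1) < q)
    (ha : 1 < a) (hb : 1 ≤ b) (h : P p q = J'' a b) : a + b = 2 * p + 1 := by
  have hm : 2 * b ≤ a * b := Nat.mul_le_mul_right b ha
  have hpp : p ≤ p ^ 2 := Nat.le_self_pow two_ne_zero p
  have hq2 : 2 * p ^ 2 + 2 * p < q := by linarith
  have hcoeff (n : ℕ) : (P p q).coeff n = (J'' a b).coeff n := by rw [h]
  have h1 := hcoeff (a + b)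
  have h2 := hcoeff (2 * p + 1)
  simp only [P, J'', coeff_sub, coeff_add, coeff_X_pow, coeff_one] at h1 h2
  generalize a * b = m at *
  generalize p ^ 2 = r at *
  rcases lt_trichotomy (a + b) (2 * p + 1) with hlt | heq | hgt
  · clear h2 hcoeff h
    rw [if_neg (show a + b ≠ 0 by omega),
      if_neg (show a + b ≠ 2 * p + 1 by omega), if_neg (show a + b ≠ 2 * p + 3 by omega),
      if_neg (show a + b ≠ 4 * p + 2 by omega), if_neg (show a + b ≠ r + 3 * p + 1 by omega),
      if_neg (show a + b ≠ r + 3 * p + 2 by omega),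
      if_neg (show a + b ≠ q - r + p + 1 by omega),
      if_neg (show a + b ≠ q - r + p + 2 by omega), if_true,
      if_neg (show a + b ≠ a + b + 2 by omega), if_neg (show a + b ≠ 2 * a + 2 * b by omega),
      if_neg (show a + b ≠ m + a + b + 1 by omega), if_neg (show a + b ≠ m + a + b + 2 by omega),
      if_neg (show a + b ≠ m + 2 * a - 1 by omega), if_neg (show a + b ≠ m + 2 * a by omega)] at h1
    omega
  · exact heq
  · clear h1 hcoeff h
    rw [if_neg (show 2 * p + 1 ≠ 0 by omega),
      if_true, if_neg (show 2 * p + 1 ≠ 2 * p + 3 by omega),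
      if_neg (show 2 * p + 1 ≠ 4 * p + 2 by omega), if_neg (show 2 * p + 1 ≠ r + 3 * p + 1 by omega),
      if_neg (show 2 * p + 1 ≠ r + 3 * p + 2 by omega),
      if_neg (show 2 * p + 1 ≠ q - r + p + 1 by omega),
      if_neg (show 2 * p + 1 ≠ q - r + p + 2 by omega), if_neg (show 2 * p + 1 ≠ a + b by omega),
      if_neg (show 2 * p + 1 ≠ a + b + 2 by omega), if_neg (show 2 * p + 1 ≠ 2 * a + 2 * b by omega),
      if_neg (show 2 * p + 1 ≠ m + a + b + 1 by omega), if_neg (show 2 * p + 1 ≠ m + a + b + 2 by omega),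
      if_neg (show 2 * p + 1 ≠ m + 2 * a - 1 by omega), if_neg (show 2 * p + 1 ≠ m + 2 * a by omega)] at h2
    omega

theorem eq_of_P_eq_J'' {p q a b : ℕ} (hp : 1 ≤ p) (hq : 2 * p * (p + 1) < q)
    (ha : 1 < a) (hb : 1 ≤ b) (h : P p q = J'' a b) :
    a = p + 1 ∧ b = p ∧ q = 2 * p * (p + 1) + 1 := by
  have hs := add_eq_of_P_eq_J'' hp hq ha hb h
  have hq2 : 2 * p ^ 2 + 2 * p < q := by linarith
  obtain ⟨hD, hC⟩ := exponents_eq_of_mul_one_sub_X_eq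
    (A := p ^ 2 + 3 * p + 1) (B := q - p ^ 2 + p + 1)
    (C := a * b + a + b + 1) (D := a * b + 2 * a - 1) (by omega) (by
      have e1 : a * b + 2 * a - 1 + 1 = a * b + 2 * a := by omega
      have e2 : 2 * a + 2 * b = 4 * p + 2 := by omega
      have e3 : a + b + 2 = 2 * p + 3 := by omega
      rw [e1]
      rw [P, J'', e2, e3, hs] at h
      linear_combination h)
  have hroots : ((a : ℤ) - (p + 1)) * (a - (p + 2)) = 0 := by
    have hD' : a * b + 2 * a = p ^ 2 + 3 * p + 2 := by omega
    zify at hD' hs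
    linear_combination (a : ℤ) * hs - hD'
  have hlt : a * b + 2 * a - 1 < a * b + a + b + 1 := by omega
  have hap : a = p + 1 := by
    rcases mul_eq_zero.mp hroots with h0 | h0 <;> omega
  obtain rfl : b = p := by omega
  refine ⟨hap, rfl, ?_⟩
  have : 2 * b * (b + 1) = 2 * b ^ 2 + 2 * b := by ring
  omega

theorem P_eq_J'' (p : ℕ) : P p (2 * p * (p + 1) + 1) = J'' (p + 1) p := by
  have e1 : 2 * p * (p + 1) + 1 - p ^ 2 = p ^ 2 + 2 * p + 1 := by
    have : 2 * p * (p + 1) = 2 * p ^ 2 + 2 * p := by ring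
    omega
  have e2 : (p + 1) * p + 2 * (p + 1) - 1 = p ^ 2 + 3 * p + 1 := by
    have : (p + 1) * p = p ^ 2 + p := by ring
    omega
  rw [P, J'', e1, e2]
  ring

/-- an algebraic knot of type `{(p,p+1),(2,q)}` has the normalized Jones
polynomial of some `K''_{a,b}` if and only if `q = 2p(p+1)+1`, in which case it must be
`K''_{p+1,p}`. -/
theorem stmt_19 (p q : ℕ) (hp : 1 ≤ p) (hq : Odd q) (hq' : 2 * p * (p + 1) < q) :
    ((∃ a b : ℕ, 1 < a ∧ 1 ≤ b ∧ P p q = J'' a b) ↔ q = 2 * p * (p + 1) + 1) ∧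
    (∀ a b : ℕ, 1 < a → 1 ≤ b → P p q = J'' a b → a = p + 1 ∧ b = p) ∧
    (q = 2 * p * (p + 1) + 1 → P p q = J'' (p + 1) p) := by
  refine ⟨⟨?_, ?_⟩, ?_, ?_⟩
  · rintro ⟨a, b, ha, hb, h⟩
    exact (eq_of_P_eq_J'' hp hq' ha hb h).2.2
  · rintro rfl
    exact ⟨p + 1, p, by omega, hp, P_eq_J'' p⟩
  · intro a b ha hb h
    obtain ⟨h1, h2, -⟩ := eq_of_P_eq_J'' hp hq' ha hb h
    exact ⟨h1, h2⟩
  · rintro rfl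
    exact P_eq_J'' p
end
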